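/- Let S := [[0, 1],[−1, 0]]. For every g ∈ SL₂(ℝ), every real t > 0, and all vectors m, n ∈ ℝ²: (i) φ_{(2,0)}(t⁻¹·g⁻¹·m, t·gᵀ·n) = φ_{(0,2)}(t·g⁻¹·(S·n), t⁻¹·gᵀ·(S·m)); and (ii) φ_{(1,1)}(t⁻¹·g⁻¹·m, t·gᵀ·n) = −φ_{(1,1)}(t·g⁻¹·(S·n), t⁻¹·gᵀ·(S·m)). -/

import Mathlib

open Matrix Real

/-- The physicists' Hermite polynomials: `H₀(x) = 1`, `H₁(x) = 2x`,
`H_{d+1}(x) = 2x·H_d(x) − 2d·H_{d−1}(x)` (so `H₂(x) = 4x² − 2`). -/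
noncomputable def hermiteP : ℕ → ℝ → ℝ
  | 0 => fun _ => 1
  | 1 => fun x => 2 * x
  | (d + 2) => fun x => 2 * x * hermiteP (d + 1) x - 2 * (d + 1) * hermiteP d x

/-- The Schwartz function `φ_{(d₁,d₂)}` on pairs of vectors `m, n ∈ ℝ²`:
`φ_{(d₁,d₂)}(m,n) = (1/4π) e^{−π‖m‖² − π‖n‖²} H_{d₁}(√π(m₁+n₁)) H_{d₂}(√π(m₂+n₂))`,
where `‖·‖` is the Euclidean norm. -/
noncomputable def phi (d₁ d₂ : ℕ) (m n : Fin 2 → ℝ) : ℝ :=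
  (1 / (4 * π)) * Real.exp (-(π * (m 0 ^ 2 + m 1 ^ 2)) - π * (n 0 ^ 2 + n 1 ^ 2))
    * hermiteP d₁ (Real.sqrt π * (m 0 + n 0)) * hermiteP d₂ (Real.sqrt π * (m 1 + n 1))

theorem phi_aux20 (M N : Fin 2 → ℝ) :
    phi 2 0 M N = phi 0 2 ![N 1, -N 0] ![M 1, -M 0] := by
  simp only [phi, hermiteP, Matrix.cons_val_zero, Matrix.cons_val_one]
  have h : -(π * (N 1 ^ 2 + (-N 0) ^ 2)) - π * (M 1 ^ 2 + (-M 0) ^ 2)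
      = -(π * (M 0 ^ 2 + M 1 ^ 2)) - π * (N 0 ^ 2 + N 1 ^ 2) := by ring
  rw [h]
  ring

theorem phi_aux11 (M N : Fin 2 → ℝ) :
    phi 1 1 M N = -phi 1 1 ![N 1, -N 0] ![M 1, -M 0] := by
  simp only [phi, hermiteP, Matrix.cons_val_zero, Matrix.cons_val_one]
  have h : -(π * (N 1 ^ 2 + (-N 0) ^ 2)) - π * (M 1 ^ 2 + (-M 0) ^ 2)
      = -(π * (M 0 ^ 2 + M 1 ^ 2)) - π * (N 0 ^ 2 + N 1 ^ 2) := by ring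
  rw [h]
  ring

/-- With `S = [[0,1],[−1,0]]`: for `g ∈ SL₂(ℝ)`, `t > 0` and `m, n ∈ ℝ²`,
`φ_{(2,0)}(t⁻¹g⁻¹m, tgᵀn) = φ_{(0,2)}(tg⁻¹(Sn), t⁻¹gᵀ(Sm))` and
`φ_{(1,1)}(t⁻¹g⁻¹m, tgᵀn) = −φ_{(1,1)}(tg⁻¹(Sn), t⁻¹gᵀ(Sm))`. -/
theorem phi_functional_symmetry
    (S : Matrix (Fin 2) (Fin 2) ℝ) (hS : S = !![0, 1; -1, 0])
    (g : Matrix.SpecialLinearGroup (Fin 2) ℝ) (t : ℝ) (ht : 0 < t)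
    (m n : Fin 2 → ℝ) :
    phi 2 0 (t⁻¹ • (↑(g⁻¹) : Matrix (Fin 2) (Fin 2) ℝ).mulVec m)
        (t • ((g : Matrix (Fin 2) (Fin 2) ℝ)ᵀ.mulVec n))
      = phi 0 2 (t • (↑(g⁻¹) : Matrix (Fin 2) (Fin 2) ℝ).mulVec (S.mulVec n))
          (t⁻¹ • ((g : Matrix (Fin 2) (Fin 2) ℝ)ᵀ.mulVec (S.mulVec m)))
    ∧ phi 1 1 (t⁻¹ • (↑(g⁻¹) : Matrix (Fin 2) (Fin 2) ℝ).mulVec m)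
        (t • ((g : Matrix (Fin 2) (Fin 2) ℝ)ᵀ.mulVec n))
      = -phi 1 1 (t • (↑(g⁻¹) : Matrix (Fin 2) (Fin 2) ℝ).mulVec (S.mulVec n))
          (t⁻¹ • ((g : Matrix (Fin 2) (Fin 2) ℝ)ᵀ.mulVec (S.mulVec m))) := by
  rw [phi_aux20, phi_aux11 (t⁻¹ • _)]
  have h1 : t • (↑(g⁻¹) : Matrix (Fin 2) (Fin 2) ℝ).mulVec (S.mulVec n)
      = ![(t • ((g : Matrix (Fin 2) (Fin 2) ℝ)ᵀ.mulVec n)) 1,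
          -(t • ((g : Matrix (Fin 2) (Fin 2) ℝ)ᵀ.mulVec n)) 0] := by
    subst hS
    ext i
    fin_cases i <;>
      simp [ht.ne', Matrix.SpecialLinearGroup.coe_inv, Matrix.adjugate_fin_two, Matrix.mulVec,
        dotProduct, Fin.sum_univ_two] <;> ring
  have h2 : t⁻¹ • ((g : Matrix (Fin 2) (Fin 2) ℝ)ᵀ.mulVec (S.mulVec m))
      = ![(t⁻¹ • (↑(g⁻¹) : Matrix (Fin 2) (Fin 2) ℝ).mulVec m) 1,
          -(t⁻¹ • (↑(g⁻¹) : Matrix (Fin 2) (Fin 2) ℝ).mulVec m) 0] := by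
    subst hS
    ext i
    fin_cases i <;>
      simp [ht.ne', Matrix.SpecialLinearGroup.coe_inv, Matrix.adjugate_fin_two, Matrix.mulVec,
        dotProduct, Fin.sum_univ_two] <;> ring
  rw [h1, h2]
  exact ⟨rfl, rfl⟩
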